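/- arXiv:1312.6631 — 2 statements merged into one kernel-verified Lean document; each statement's English description precedes it below -/
import Mathlib

section
/- Let M₁ (of size n₁×n₁) and M₂ (of size n₂×n₂) be real symmetric positive definite tridiagonal matrices, with extreme eigenvalues λ_min(M₁) < λ_max(M₁) and λ_min(M₂) < λ_max(M₂), and let S_g = M₁ ⊗ I_{n} + I_{n} ⊗ M₂, with the vectorization convention making columns of S_g⁻¹ solutions of M₁ X + X M₂ = e_i e_jᵀ. Set δ₁₂ = (λ_max(M₁) − λ_min(M₁))(λ_max(M₂) − λ_min(M₂)). For k, t ∈ {1, …, n₁n₂} let j = ⌊(t−1)/n₁⌋ + 1, i = t − n₁⌊(t−1)/n₁⌋, and similarly for k let ℓ' and m' be the row/column grid indices of k. For ω ∈ ℝ define α_p(ω) = (√(λ_min(M_p)² + ω²) + √(λ_max(M_p)² + ω²))/(λ_max(M_p) − λ_min(M_p)) and R_p(ω) = α_p(ω) + √(α_p(ω)² − 1) for p = 1, 2. If the row grid index of k differs from i and the column grid index of k differs from j, then |(S_g⁻¹)_{k,t}| ≤ (1/(2π)) · (64/δ₁₂) · ∫_{−∞}^{∞} (R₁²/(R₁²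 − 1)²) · (R₂²/(R₂² − 1)²) · (1/R₁)^{|i−ℓ'|−1} · (1/R₂)^{|j−m'|−1} dω. -/
open MeasureTheory Real Matrix

/-- The Kronecker sum `S_g` associated with `M₁` (size `n₁`) and `M₂` (size `n₂`),
written entrywise with 0-based indices: for `k, t ∈ Fin (n₁ * n₂)`, the row grid
index is `k % n₁` (acted on by `M₁`) and the column grid index is `k / n₁`
(acted on by `M₂`), so that the `t`-th column of `S_g⁻¹`, reshaped columnwise,
solves the Sylvester equation `M₁ X + X M₂ = e_i e_jᵀ`. -/
noncomputable def kronSum2 (n₁ n₂ : ℕ)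
    (M₁ : Matrix (Fin n₁) (Fin n₁) ℝ) (M₂ : Matrix (Fin n₂) (Fin n₂) ℝ) :
    Matrix (Fin (n₁ * n₂)) (Fin (n₁ * n₂)) ℝ := fun k t =>
  have h1 : 0 < n₁ := by
    rcases Nat.eq_zero_or_pos n₁ with h | h
    · subst h; exact absurd k.2 (by simp)
    · exact h
  (if (k : ℕ) / n₁ = (t : ℕ) / n₁ then
      M₁ ⟨(k : ℕ) % n₁, Nat.mod_lt _ h1⟩ ⟨(t : ℕ) % n₁, Nat.mod_lt _ h1⟩
    else 0) +
  (if (k : ℕ) % n₁ = (t : ℕ) % n₁ then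
      M₂ ⟨(k : ℕ) / n₁, Nat.div_lt_of_lt_mul k.2⟩ ⟨(t : ℕ) / n₁, Nat.div_lt_of_lt_mul t.2⟩
    else 0)

open Polynomial in
theorem Polynomial.Chebyshev.T_eval_joukowski {w : ℂ} (hw : w ≠ 0) (n : ℤ) :
    (Chebyshev.T ℂ n).eval ((w + w⁻¹) / 2) = (w ^ n + (w ^ n)⁻¹) / 2 := by
  obtain ⟨l, rfl⟩ : ∃ l, Complex.exp l = w := ⟨_, Complex.exp_log hw⟩
  rw [← Complex.exp_neg, ← Complex.exp_int_mul, ← Complex.exp_neg]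
  have h := Chebyshev.T_complex_cosh l n
  rwa [Complex.cosh, Complex.cosh] at h

open Polynomial in
/-- Near-optimal polynomial approximation of `x ↦ 1 / (x - a)` on `[-1, 1]`, where
`a = (w + w⁻¹) / 2` lies outside the interval. -/
theorem exists_polynomial_approx_inv_sub {w : ℂ} (hw : 1 < ‖w‖) (n : ℕ) :
    ∃ p : ℂ[X], p.natDegree ≤ n ∧ ∀ x : ℝ, |x| ≤ 1 →
      ‖1 / ((x : ℂ) - (w + w⁻¹) / 2) - p.eval (x : ℂ)‖ ≤
        4 * (‖w‖ ^ 2 / (‖w‖ ^ 2 - 1) ^ 2) * (1 / ‖w‖) ^ n := by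
  set v : ℂ := starRingEnd ℂ w
  set a : ℂ := (w + w⁻¹) / 2
  have hw0 : w ≠ 0 := by rintro rfl; simp at hw; linarith
  have hρ0 : 0 < ‖w‖ := by linarith
  have hρ2 : 0 < ‖w‖ ^ 2 - 1 := by nlinarith
  have hww : w * v = ((‖w‖ ^ 2 : ℝ) : ℂ) := by
    rw [Complex.mul_conj, Complex.normSq_eq_norm_sq]
  have hnv : ‖1 - v * w‖ = ‖w‖ ^ 2 - 1 := by
    rw [mul_comm, hww, ← Complex.ofReal_one, ← Complex.ofReal_sub, Complex.norm_real,
      Real.norm_eq_abs, abs_sub_comm, abs_of_pos hρ2]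
  have hnw : ‖w‖ ^ 2 - 1 ≤ ‖1 - w * w‖ := by
    have := norm_sub_norm_le (w * w) 1
    rw [norm_sub_rev, norm_mul, norm_one] at this
    linarith [sq ‖w‖]
  have hnv0 : 1 - v * w ≠ 0 := by rw [← norm_pos_iff, hnv]; exact hρ2
  have hnw0 : 1 - w * w ≠ 0 := by rw [← norm_pos_iff]; linarith
  set G : ℂ[X] := Chebyshev.T ℂ ((n : ℤ) - 1) - C (w + v) * Chebyshev.T ℂ n +
    C (w * v) * Chebyshev.T ℂ ((n : ℤ) + 1)
  have hG : ∀ z : ℂ, z ≠ 0 → G.eval ((z + z⁻¹) / 2) =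
      (z ^ ((n : ℤ) - 1) * ((1 - w * z) * (1 - v * z)) +
        (z ^ ((n : ℤ) - 1))⁻¹ * ((1 - w * z⁻¹) * (1 - v * z⁻¹))) / 2 := by
    intro z hz
    simp only [G, eval_add, eval_sub, eval_mul, eval_C, Chebyshev.T_eval_joukowski hz,
      zpow_sub₀ hz, zpow_add₀ hz, zpow_one]
    field_simp
    ring
  set κ : ℂ := 2 / (w ^ ((n : ℤ) - 1) * ((1 - w * w) * (1 - v * w)))
  have hq1 : (C κ * G).eval a = 1 := by
    rw [eval_mul, eval_C, hG w hw0, mul_inv_cancel₀ hw0]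
    have hP := mul_ne_zero (zpow_ne_zero ((n : ℤ) - 1) hw0) (mul_ne_zero hnw0 hnv0)
    simp only [κ, sub_self, zero_mul, mul_zero, add_zero]
    rw [div_mul_div_cancel₀ hP, div_self two_ne_zero]
  obtain ⟨p, hp⟩ : X - C a ∣ 1 - C κ * G := by
    rw [dvd_iff_isRoot, IsRoot, eval_sub, hq1, eval_one, sub_self]
  refine ⟨p, ?_, ?_⟩
  · have hdeg : (1 - C κ * G).natDegree ≤ n + 1 := by
      refine (natDegree_sub_le _ _).trans (max_le (by simp) ?_)
      refine (natDegree_C_mul_le _ _).trans ?_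
      refine (natDegree_add_le _ _).trans (max_le ((natDegree_sub_le _ _).trans (max_le ?_ ?_)) ?_)
      · rw [Chebyshev.natDegree_T]; omega
      · refine (natDegree_C_mul_le _ _).trans ?_
        rw [Chebyshev.natDegree_T]; omega
      · refine (natDegree_C_mul_le _ _).trans ?_
        rw [Chebyshev.natDegree_T]; omega
    by_cases hp0 : p = 0
    · simp [hp0]
    · rw [hp, natDegree_mul (X_sub_C_ne_zero a) hp0, natDegree_X_sub_C] at hdeg
      omega
  · intro x hx
    obtain ⟨z, hz, hzx⟩ : ∃ z : ℂ, ‖z‖ = 1 ∧ (x : ℂ) = (z + z⁻¹) / 2 := by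
      refine ⟨Complex.exp (Real.arccos x * Complex.I), Complex.norm_exp_ofReal_mul_I _, ?_⟩
      rw [← Complex.exp_neg, ← neg_mul, ← Complex.cos, ← Complex.ofReal_cos,
        Real.cos_arccos (abs_le.1 hx).1 (abs_le.1 hx).2]
    have hz0 : z ≠ 0 := by rw [← norm_pos_iff, hz]; exact one_pos
    have hzc : starRingEnd ℂ z = z⁻¹ := by
      rw [Complex.inv_def, Complex.normSq_eq_norm_sq, hz]; simp
    have hw1 : ∀ y : ℂ, ‖y‖ = 1 → ‖1 - w * y‖ = ‖y⁻¹ - w‖ := by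
      intro y hy
      have hy0 : y ≠ 0 := by rw [← norm_pos_iff, hy]; exact one_pos
      rw [← one_mul ‖y⁻¹ - w‖, ← hy, ← norm_mul, mul_sub, mul_inv_cancel₀ hy0, mul_comm w]
    have hv1 : ∀ y : ℂ, ‖1 - v * y‖ = ‖1 - w * starRingEnd ℂ y‖ := by
      intro y
      rw [← Complex.norm_conj]
      simp [v]
    have hzi : ‖z⁻¹‖ = 1 := by simp [hz]
    have hGn : ‖G.eval (x : ℂ)‖ ≤ ‖z - w‖ * ‖z⁻¹ - w‖ := by
      rw [hzx, hG z hz0, norm_div, Complex.norm_ofNat, div_le_iff₀ two_pos]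
      refine (norm_add_le _ _).trans (le_of_eq ?_)
      simp only [norm_mul, norm_inv, norm_zpow, hz, _root_.one_zpow, inv_one, one_mul]
      rw [hv1, hv1, map_inv₀, hzc, inv_inv, hw1 z hz, hw1 _ hzi, inv_inv]
      ring
    have hxa : (x : ℂ) - a = -((z - w) * (z⁻¹ - w) / (2 * w)) := by
      rw [hzx]; simp only [a]; field_simp; ring
    have hzw : 0 < ‖z - w‖ := by
      have := norm_sub_norm_le w z
      rw [norm_sub_rev]; linarith
    have hzw' : 0 < ‖z⁻¹ - w‖ := by
      have := norm_sub_norm_le w z⁻¹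
      rw [norm_sub_rev]; linarith
    have hxan : ‖(x : ℂ) - a‖ = ‖z - w‖ * ‖z⁻¹ - w‖ / (2 * ‖w‖) := by
      rw [hxa, norm_neg, norm_div, norm_mul, norm_mul, Complex.norm_ofNat]
    have hxa0 : (x : ℂ) - a ≠ 0 := by rw [← norm_pos_iff, hxan]; positivity
    have hpx := congrArg (eval (x : ℂ)) hp
    simp only [eval_sub, eval_one, eval_mul, eval_C, eval_X] at hpx
    have herr : 1 / ((x : ℂ) - a) - p.eval (x : ℂ) = κ * G.eval (x : ℂ) / ((x : ℂ) - a) := by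
      rw [eq_div_iff hxa0, sub_mul, one_div_mul_cancel hxa0]
      linear_combination hpx
    have hκ : ‖κ‖ ≤ 2 * ‖w‖ * (1 / ‖w‖) ^ n / (‖w‖ ^ 2 - 1) ^ 2 := by
      simp only [κ, norm_div, norm_mul, norm_zpow, Complex.norm_ofNat, hnv]
      rw [zpow_sub₀ hρ0.ne', zpow_one, zpow_natCast]
      calc 2 / (‖w‖ ^ n / ‖w‖ * (‖1 - w * w‖ * (‖w‖ ^ 2 - 1)))
          ≤ 2 / (‖w‖ ^ n / ‖w‖ * ((‖w‖ ^ 2 - 1) * (‖w‖ ^ 2 - 1))) := by gcongr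
        _ = _ := by rw [one_div, inv_pow]; field_simp
    rw [herr, norm_div, norm_mul, hxan, div_le_iff₀ (by positivity)]
    calc ‖κ‖ * ‖G.eval (x : ℂ)‖
        ≤ (2 * ‖w‖ * (1 / ‖w‖) ^ n / (‖w‖ ^ 2 - 1) ^ 2) * (‖z - w‖ * ‖z⁻¹ - w‖) := by gcongr
      _ = _ := by field_simp; ring

theorem exists_joukowski_preimage {a : ℂ} {α : ℝ} (hα : (‖a - 1‖ + ‖a + 1‖) / 2 = α)
    (h1 : 1 < α) :
    ∃ w : ℂ, 1 < ‖w‖ ∧ a = (w + w⁻¹) / 2 ∧ ‖w‖ = α + √(α ^ 2 - 1) := by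
  obtain ⟨s, hs⟩ := IsAlgClosed.exists_pow_nat_eq (a ^ 2 - 1) two_pos
  have hmul : (a + s) * (a - s) = 1 := by linear_combination -hs
  obtain ⟨w, hw1, hw⟩ : ∃ w : ℂ, 1 ≤ ‖w‖ ∧ w * (2 * a - w) = 1 := by
    by_cases h : 1 ≤ ‖a + s‖
    · exact ⟨a + s, h, by linear_combination hmul⟩
    · refine ⟨a - s, ?_, by linear_combination hmul⟩
      have hn := congrArg norm hmul
      rw [norm_mul, norm_one] at hn
      nlinarith [norm_nonneg (a + s), norm_nonneg (a - s)]
  have hw0 : w ≠ 0 := by rintro rfl; simp at hw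
  have hρ0 : 0 < ‖w‖ := by linarith
  have ha : a = (w + w⁻¹) / 2 := by field_simp; linear_combination hw
  have hm : ‖a - 1‖ = ‖w - 1‖ ^ 2 / (2 * ‖w‖) := by
    have : a - 1 = (w - 1) ^ 2 / (2 * w) := by rw [ha]; field_simp; ring
    rw [this, norm_div, norm_pow, norm_mul, Complex.norm_ofNat]
  have hp : ‖a + 1‖ = ‖w + 1‖ ^ 2 / (2 * ‖w‖) := by
    have : a + 1 = (w + 1) ^ 2 / (2 * w) := by rw [ha]; field_simp; ring
    rw [this, norm_div, norm_pow, norm_mul, Complex.norm_ofNat]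
  have hpar := parallelogram_law_with_norm ℝ w 1
  rw [norm_one] at hpar
  have hα2 : ‖w‖ ^ 2 + 1 = 2 * α * ‖w‖ := by
    rw [← hα, hm, hp]
    field_simp
    linear_combination (-1) * hpar
  have hsq : α ^ 2 - 1 = (‖w‖ - α) ^ 2 := by linear_combination -hα2
  have hge : α ≤ ‖w‖ := by nlinarith
  refine ⟨w, by linarith, ha, ?_⟩
  rw [hsq, Real.sqrt_sq (by linarith)]
  ring

open Polynomial in
theorem exists_polynomial_approx_inv_add {lo hi : ℝ} (hlt : lo < hi) (s : ℂ) {α R : ℝ}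
    (hα : α = (‖lo + s‖ + ‖hi + s‖) / (hi - lo)) (hα1 : 1 < α) (hR : R = α + √(α ^ 2 - 1))
    (n : ℕ) :
    ∃ p : ℂ[X], p.natDegree ≤ n ∧ ∀ x : ℝ, lo ≤ x → x ≤ hi →
      ‖1 / ((x : ℂ) + s) - p.eval (x : ℂ)‖ ≤
        8 / (hi - lo) * (R ^ 2 / (R ^ 2 - 1) ^ 2) * (1 / R) ^ n := by
  set h : ℝ := (hi - lo) / 2 with hh
  set c : ℝ := (hi + lo) / 2 with hc
  have hpos : 0 < h := by rw [hh]; linarith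
  have hC : (h : ℂ) ≠ 0 := by exact_mod_cast hpos.ne'
  have hnorm : ∀ y : ℂ, ‖y / h‖ = ‖y‖ / h := fun y => by
    rw [norm_div, Complex.norm_real, Real.norm_of_nonneg hpos.le]
  have ham : ‖-(c + s) / h - 1‖ = ‖hi + s‖ / h := by
    rw [← hnorm, ← norm_neg]
    congr 1
    field_simp
    simp only [hh, hc]; push_cast; ring
  have hap : ‖-(c + s) / h + 1‖ = ‖lo + s‖ / h := by
    rw [← hnorm, ← norm_neg]
    congr 1
    field_simp
    simp only [hh, hc]; push_cast; ring
  have hαa : (‖-(c + s) / h - 1‖ + ‖-(c + s) / h + 1‖) / 2 = α := by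
    rw [ham, hap, hα, hh]
    have : hi - lo ≠ 0 := by linarith
    field_simp
    ring
  obtain ⟨w, hw1, haw, hwR⟩ := exists_joukowski_preimage hαa hα1
  obtain ⟨p, hpd, hp⟩ := exists_polynomial_approx_inv_sub hw1 n
  refine ⟨C (1 / (h : ℂ)) * p.comp (C (1 / (h : ℂ)) * (X - C (c : ℂ))), ?_, ?_⟩
  · refine (natDegree_C_mul_le _ _).trans (natDegree_comp_le.trans ?_)
    refine (Nat.mul_le_mul hpd ((natDegree_C_mul_le _ _).trans_eq (natDegree_X_sub_C _))).trans ?_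
    rw [mul_one]
  · intro x hx1 hx2
    have hy : |(x - c) / h| ≤ 1 := by
      rw [abs_div, abs_of_pos hpos, div_le_one hpos, abs_le]
      constructor <;> simp only [hh, hc] <;> linarith
    have key := hp _ hy
    rw [← haw, hwR, ← hR] at key
    have e : 1 / ((x : ℂ) + s) -
        (C (1 / (h : ℂ)) * p.comp (C (1 / (h : ℂ)) * (X - C (c : ℂ)))).eval (x : ℂ) =
        (1 / ((((x - c) / h : ℝ) : ℂ) - -(c + s) / h) -
          p.eval ((((x - c) / h : ℝ) : ℂ))) / h := by
      have e1 : (((x - c) / h : ℝ) : ℂ) - -(c + s) / h = (x + s) / h := by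
        push_cast; field_simp; ring
      rw [e1]
      simp only [eval_mul, eval_C, eval_comp, eval_sub, eval_X]
      rw [one_div_div, show (1 / (h : ℂ) * (x - c)) = (((x - c) / h : ℝ) : ℂ) by
        push_cast; ring]
      field_simp
    rw [e, hnorm, div_le_iff₀ hpos]
    refine key.trans (le_of_eq ?_)
    have : hi - lo ≠ 0 := by linarith
    rw [hh]
    field_simp
    ring

theorem Matrix.IsHermitian.pow_apply_eq_sum {n : Type*} [Fintype n] [DecidableEq n]
    {A : Matrix n n ℝ} (hA : A.IsHermitian) (k : ℕ) (a b : n) :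
    (A ^ k) a b = ∑ e, (hA.eigenvectorUnitary : Matrix n n ℝ) a e *
      (hA.eigenvectorUnitary : Matrix n n ℝ) b e * hA.eigenvalues e ^ k := by
  conv_lhs => rw [hA.spectral_theorem, ← map_pow, Unitary.conjStarAlgAut_apply, diagonal_pow]
  rw [mul_apply]
  refine Finset.sum_congr rfl fun e _ => ?_
  rw [mul_diagonal, star_apply]
  simp
  ring

theorem Matrix.IsHermitian.sum_eigenvectorUnitary_mul_mul_eigenvalues {n : Type*} [Fintype n]
    [DecidableEq n] {A : Matrix n n ℝ} (hA : A.IsHermitian) (a e : n) :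
    ∑ b, A a b * (hA.eigenvectorUnitary : Matrix n n ℝ) b e =
      (hA.eigenvectorUnitary : Matrix n n ℝ) a e * hA.eigenvalues e := by
  have h := congrFun (hA.mulVec_eigenvectorBasis e) a
  simpa [mulVec, dotProduct, hA.eigenvectorUnitary_apply, mul_comm] using h

theorem Matrix.IsHermitian.sum_eigenvectorUnitary_mul {n : Type*} [Fintype n] [DecidableEq n]
    {A : Matrix n n ℝ} (hA : A.IsHermitian) (a b : n) :
    ∑ e, (hA.eigenvectorUnitary : Matrix n n ℝ) a e * (hA.eigenvectorUnitary : Matrix n n ℝ) b e =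
      if a = b then 1 else 0 := by
  simpa [one_apply] using (hA.pow_apply_eq_sum 0 a b).symm

theorem Matrix.pow_apply_eq_zero_of_tridiagonal {n : ℕ} {A : Matrix (Fin n) (Fin n) ℝ}
    (htri : ∀ a c : Fin n, 1 < |(a : ℤ) - (c : ℤ)| → A a c = 0) (k : ℕ) (a c : Fin n)
    (h : (k : ℤ) < |(a : ℤ) - (c : ℤ)|) : (A ^ k) a c = 0 := by
  induction k generalizing c with
  | zero =>
    rw [pow_zero, one_apply_ne]
    rintro rfl
    simp at h
  | succ k ih =>
    rw [pow_succ, mul_apply]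
    refine Finset.sum_eq_zero fun b _ => ?_
    by_cases hb : (k : ℤ) < |(a : ℤ) - (b : ℤ)|
    · rw [ih b hb, zero_mul]
    · rw [htri b c, mul_zero]
      have := abs_sub_le (a : ℤ) b c
      push_cast at h
      omega

/-- Entrywise decay of the resolvent `(A + s)⁻¹` of a symmetric tridiagonal matrix, with the
entries expressed in an eigenbasis. -/
theorem Matrix.IsHermitian.norm_resolvent_entry_le {N : ℕ} {A : Matrix (Fin N) (Fin N) ℝ}
    (hA : A.IsHermitian) (htri : ∀ a c : Fin N, 1 < |(a : ℤ) - (c : ℤ)| → A a c = 0)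
    {lo hi : ℝ} (hlo : ∀ e, lo ≤ hA.eigenvalues e) (hhi : ∀ e, hA.eigenvalues e ≤ hi)
    (hlt : lo < hi) (s : ℂ) {α R : ℝ}
    (hα : α = (‖lo + s‖ + ‖hi + s‖) / (hi - lo)) (hα1 : 1 < α) (hR : R = α + √(α ^ 2 - 1))
    {n : ℕ} {a b : Fin N} (hab : (n : ℤ) < |(a : ℤ) - (b : ℤ)|) :
    ‖∑ e, (((hA.eigenvectorUnitary : Matrix (Fin N) (Fin N) ℝ) a e *
        (hA.eigenvectorUnitary : Matrix (Fin N) (Fin N) ℝ) b e : ℝ) : ℂ) *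
          (1 / (hA.eigenvalues e + s))‖ ≤
      8 / (hi - lo) * (R ^ 2 / (R ^ 2 - 1) ^ 2) * (1 / R) ^ n := by
  obtain ⟨p, hpd, hp⟩ := exists_polynomial_approx_inv_add hlt s hα hα1 hR n
  set U : Matrix (Fin N) (Fin N) ℝ := (hA.eigenvectorUnitary : Matrix (Fin N) (Fin N) ℝ)
  set B : ℝ := 8 / (hi - lo) * (R ^ 2 / (R ^ 2 - 1) ^ 2) * (1 / R) ^ n
  have hB : 0 ≤ B := (norm_nonneg _).trans (hp lo le_rfl hlt.le)
  have hzero : ∑ e, ((U a e * U b e : ℝ) : ℂ) * p.eval (hA.eigenvalues e : ℂ) = 0 := by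
    simp only [Polynomial.eval_eq_sum_range, Finset.mul_sum]
    rw [Finset.sum_comm]
    refine Finset.sum_eq_zero fun k hk => ?_
    have hk' : (k : ℤ) < |(a : ℤ) - (b : ℤ)| := by
      have := Finset.mem_range.1 hk
      omega
    have h0 := hA.pow_apply_eq_sum k a b
    rw [pow_apply_eq_zero_of_tridiagonal htri k a b hk'] at h0
    have h1 := congrArg (fun y : ℝ => p.coeff k * (y : ℂ)) h0
    simp only [Complex.ofReal_zero, mul_zero, Complex.ofReal_sum, Finset.mul_sum] at h1
    rw [h1]
    refine Finset.sum_congr rfl fun e _ => ?_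
    push_cast
    ring
  have hsq : ∀ c, ∑ e, U c e ^ 2 = 1 := fun c => by
    simpa only [sq, if_true] using hA.sum_eigenvectorUnitary_mul c c
  rw [← sub_zero (∑ e, _), ← hzero, ← Finset.sum_sub_distrib]
  calc ‖∑ e, (((U a e * U b e : ℝ) : ℂ) * (1 / (hA.eigenvalues e + s)) -
          ((U a e * U b e : ℝ) : ℂ) * p.eval (hA.eigenvalues e : ℂ))‖
      ≤ ∑ e, (U a e ^ 2 + U b e ^ 2) / 2 * B := by
        refine norm_sum_le_of_le _ fun e _ => ?_
        rw [← mul_sub, norm_mul, Complex.norm_real, Real.norm_eq_abs]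
        refine mul_le_mul ?_ (hp _ (hlo e) (hhi e)) (norm_nonneg _) (by positivity)
        rw [abs_le]
        constructor <;> nlinarith [sq_nonneg (U a e - U b e), sq_nonneg (U a e + U b e)]
    _ = B := by
        rw [← Finset.sum_mul, ← Finset.sum_div, Finset.sum_add_distrib, hsq, hsq]
        norm_num

theorem integrable_div_sq_add_sq {l : ℝ} (hl : 0 < l) :
    Integrable fun ω : ℝ => l / (l ^ 2 + ω ^ 2) := by
  have h := (integrable_inv_one_add_sq.comp_div hl.ne').const_mul l⁻¹
  refine h.congr (Filter.Eventually.of_forall fun ω => ?_)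
  simp only
  have : l ^ 2 + ω ^ 2 ≠ 0 := by positivity
  field_simp

theorem integral_univ_div_sq_add_sq {l : ℝ} (hl : 0 < l) :
    ∫ ω : ℝ, l / (l ^ 2 + ω ^ 2) = π := by
  have h := Measure.integral_comp_div (fun x : ℝ => (1 + x ^ 2)⁻¹) l
  rw [integral_univ_inv_one_add_sq, abs_of_pos hl, smul_eq_mul] at h
  have h2 : (fun ω : ℝ => l / (l ^ 2 + ω ^ 2)) = fun ω => l⁻¹ * (1 + (ω / l) ^ 2)⁻¹ := by
    funext ω
    have : l ^ 2 + ω ^ 2 ≠ 0 := by positivity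
    field_simp
  rw [h2, integral_const_mul, h]
  field_simp

theorem re_inv_mul_inv_eq {l m : ℝ} (hl : 0 < l) (hm : 0 < m) (ω : ℝ) :
    (1 / ((l : ℂ) + ω * Complex.I) * (1 / ((m : ℂ) + ((-ω : ℝ) : ℂ) * Complex.I))).re =
      (l + m)⁻¹ * (l / (l ^ 2 + ω ^ 2) + m / (m ^ 2 + ω ^ 2)) := by
  have h1 : l ^ 2 + ω ^ 2 ≠ 0 := by positivity
  have h2 : m ^ 2 + ω ^ 2 ≠ 0 := by positivity
  have h3 : l + m ≠ 0 := by positivity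
  simp only [one_div, Complex.mul_re, Complex.inv_re, Complex.inv_im, Complex.normSq_apply,
    Complex.add_re, Complex.add_im, Complex.mul_im, Complex.ofReal_re, Complex.ofReal_im,
    Complex.I_re, Complex.I_im]
  simp only [mul_zero, mul_one, zero_add, add_zero, sub_zero, ← sq]
  field_simp
  ring

theorem sum_div_add_eq_integral {ι κ : Type*} [Fintype ι] [Fintype κ] (c l : ι → ℝ) (d m : κ → ℝ)
    (hl : ∀ e, 0 < l e) (hm : ∀ f, 0 < m f) :
    ∑ e, ∑ f, c e * d f / (l e + m f) = 1 / (2 * π) * ∫ ω : ℝ,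
      ((∑ e, (c e : ℂ) * (1 / (l e + ω * Complex.I))) *
        (∑ f, (d f : ℂ) * (1 / (m f + ((-ω : ℝ) : ℂ) * Complex.I)))).re := by
  have hre : ∀ ω : ℝ, ((∑ e, (c e : ℂ) * (1 / (l e + ω * Complex.I))) *
        (∑ f, (d f : ℂ) * (1 / (m f + ((-ω : ℝ) : ℂ) * Complex.I)))).re =
      ∑ e, ∑ f, c e * d f * ((l e + m f)⁻¹ *
        (l e / (l e ^ 2 + ω ^ 2) + m f / (m f ^ 2 + ω ^ 2))) := by
    intro ω
    rw [Finset.sum_mul_sum, Complex.re_sum]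
    refine Finset.sum_congr rfl fun e _ => ?_
    rw [Complex.re_sum]
    refine Finset.sum_congr rfl fun f _ => ?_
    rw [mul_mul_mul_comm, ← Complex.ofReal_mul, Complex.re_ofReal_mul,
      re_inv_mul_inv_eq (hl e) (hm f)]
  have hint : ∀ e f, Integrable fun ω : ℝ => c e * d f * ((l e + m f)⁻¹ *
        (l e / (l e ^ 2 + ω ^ 2) + m f / (m f ^ 2 + ω ^ 2))) := fun e f =>
    (((integrable_div_sq_add_sq (hl e)).add (integrable_div_sq_add_sq (hm f))).const_mul
      _).const_mul _
  simp only [hre]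
  rw [integral_finsetSum _ fun e _ => integrable_finsetSum _ fun f _ => hint e f, Finset.mul_sum]
  refine Finset.sum_congr rfl fun e _ => ?_
  rw [integral_finsetSum _ fun f _ => hint e f, Finset.mul_sum]
  refine Finset.sum_congr rfl fun f _ => ?_
  rw [integral_const_mul, integral_const_mul, integral_add (integrable_div_sq_add_sq (hl e))
    (integrable_div_sq_add_sq (hm f)), integral_univ_div_sq_add_sq (hl e),
    integral_univ_div_sq_add_sq (hm f)]
  have := Real.pi_ne_zero
  have := add_pos (hl e) (hm f)
  field_simp
  ring

/-- Entries of the inverse Kronecker sum in terms of eigenbases of the two factors. -/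
theorem kronSum2_inv_apply {n₁ n₂ : ℕ} {M₁ : Matrix (Fin n₁) (Fin n₁) ℝ}
    {M₂ : Matrix (Fin n₂) (Fin n₂) ℝ} (hM₁ : M₁.PosDef) (hM₂ : M₂.PosDef)
    (k t : Fin (n₁ * n₂)) (r i : Fin n₁) (c j : Fin n₂)
    (hr : (r : ℕ) = k % n₁) (hc : (c : ℕ) = k / n₁) (hi : (i : ℕ) = t % n₁)
    (hj : (j : ℕ) = t / n₁) :
    (kronSum2 n₁ n₂ M₁ M₂)⁻¹ k t = ∑ e, ∑ f,
      ((hM₁.1.eigenvectorUnitary : Matrix (Fin n₁) (Fin n₁) ℝ) r e *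
        (hM₁.1.eigenvectorUnitary : Matrix (Fin n₁) (Fin n₁) ℝ) i e) *
      ((hM₂.1.eigenvectorUnitary : Matrix (Fin n₂) (Fin n₂) ℝ) c f *
        (hM₂.1.eigenvectorUnitary : Matrix (Fin n₂) (Fin n₂) ℝ) j f) /
      (hM₁.1.eigenvalues e + hM₂.1.eigenvalues f) := by
  set U : Matrix (Fin n₁) (Fin n₁) ℝ :=
    (hM₁.1.eigenvectorUnitary : Matrix (Fin n₁) (Fin n₁) ℝ)
  set V : Matrix (Fin n₂) (Fin n₂) ℝ :=
    (hM₂.1.eigenvectorUnitary : Matrix (Fin n₂) (Fin n₂) ℝ)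
  let E : Fin n₁ × Fin n₂ ≃ Fin (n₁ * n₂) :=
    (Equiv.prodComm _ _).trans (finProdFinEquiv.trans (finCongr (mul_comm _ _)))
  have hmod : ∀ p : Fin n₁ × Fin n₂, ((E p : Fin (n₁ * n₂)) : ℕ) % n₁ = p.1 := fun p => by
    simp [E, finProdFinEquiv, Nat.mod_eq_of_lt p.1.2]
  have hdiv : ∀ p : Fin n₁ × Fin n₂, ((E p : Fin (n₁ * n₂)) : ℕ) / n₁ = p.2 := fun p => by
    have hp := p.1.2
    simp [E, finProdFinEquiv, Nat.add_mul_div_left _ _ (Nat.zero_lt_of_lt hp),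
      Nat.div_eq_of_lt hp]
  have hS : ∀ p q : Fin n₁ × Fin n₂, kronSum2 n₁ n₂ M₁ M₂ (E p) (E q) =
      (if p.2 = q.2 then M₁ p.1 q.1 else 0) + (if p.1 = q.1 then M₂ p.2 q.2 else 0) := by
    intro p q
    simp only [kronSum2, hmod, hdiv, Fin.val_inj, Fin.eta]
  let X : Matrix (Fin n₁ × Fin n₂) (Fin n₁ × Fin n₂) ℝ := fun p q => ∑ e, ∑ f,
    (U p.1 e * U q.1 e) * (V p.2 f * V q.2 f) / (hM₁.1.eigenvalues e + hM₂.1.eigenvalues f)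
  have hmul : kronSum2 n₁ n₂ M₁ M₂ * X.submatrix E.symm E.symm = 1 := by
    ext a b
    obtain ⟨p, rfl⟩ := E.surjective a
    obtain ⟨q, rfl⟩ := E.surjective b
    rw [mul_apply, ← E.sum_comp]
    simp only [hS, submatrix_apply, Equiv.symm_apply_apply, add_mul, Finset.sum_add_distrib,
      ite_mul, zero_mul]
    rw [Fintype.sum_prod_type, Fintype.sum_prod_type_right]
    simp only [Finset.sum_ite_eq, Finset.mem_univ, if_true, one_apply, E.injective.eq_iff]
    have h₁ : ∑ x, M₁ p.1 x * X (x, p.2) q = ∑ e, ∑ f, hM₁.1.eigenvalues e *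
        ((U p.1 e * U q.1 e) * (V p.2 f * V q.2 f) /
          (hM₁.1.eigenvalues e + hM₂.1.eigenvalues f)) := by
      simp only [X, Finset.mul_sum]
      rw [Finset.sum_comm]
      refine Finset.sum_congr rfl fun e _ => ?_
      rw [Finset.sum_comm]
      refine Finset.sum_congr rfl fun f _ => ?_
      have h := hM₁.1.sum_eigenvectorUnitary_mul_mul_eigenvalues p.1 e
      calc _ = (∑ b, M₁ p.1 b * U b e) * (U q.1 e * (V p.2 f * V q.2 f) /
            (hM₁.1.eigenvalues e + hM₂.1.eigenvalues f)) := by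
              rw [Finset.sum_mul]
              exact Finset.sum_congr rfl fun _ _ => by ring
        _ = _ := by rw [h]; ring
    have h₂ : ∑ y, M₂ p.2 y * X (p.1, y) q = ∑ e, ∑ f, hM₂.1.eigenvalues f *
        ((U p.1 e * U q.1 e) * (V p.2 f * V q.2 f) /
          (hM₁.1.eigenvalues e + hM₂.1.eigenvalues f)) := by
      simp only [X, Finset.mul_sum]
      rw [Finset.sum_comm]
      refine Finset.sum_congr rfl fun e _ => ?_
      rw [Finset.sum_comm]
      refine Finset.sum_congr rfl fun f _ => ?_
      have h := hM₂.1.sum_eigenvectorUnitary_mul_mul_eigenvalues p.2 f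
      calc _ = (∑ b, M₂ p.2 b * V b f) * (U p.1 e * U q.1 e * V q.2 f /
            (hM₁.1.eigenvalues e + hM₂.1.eigenvalues f)) := by
              rw [Finset.sum_mul]
              exact Finset.sum_congr rfl fun _ _ => by ring
        _ = _ := by rw [h]; ring
    rw [h₁, h₂, ← Finset.sum_add_distrib]
    calc _ = ∑ e, ∑ f, (U p.1 e * U q.1 e) * (V p.2 f * V q.2 f) := by
          refine Finset.sum_congr rfl fun e _ => ?_
          rw [← Finset.sum_add_distrib]
          refine Finset.sum_congr rfl fun f _ => ?_
          have := add_pos (hM₁.eigenvalues_pos e) (hM₂.eigenvalues_pos f)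
          rw [← add_mul, mul_div_cancel₀ _ this.ne']
      _ = _ := by
          rw [← Finset.sum_mul_sum, hM₁.1.sum_eigenvectorUnitary_mul,
            hM₂.1.sum_eigenvectorUnitary_mul, ite_zero_mul_ite_zero, one_mul]
          simp only [Prod.ext_iff]
  have hinv : (kronSum2 n₁ n₂ M₁ M₂)⁻¹ = X.submatrix E.symm E.symm := inv_eq_right_inv hmul
  have hk : E.symm k = (r, c) := by
    rw [Equiv.symm_apply_eq, Fin.ext_iff, ← Nat.mod_add_div (k : ℕ) n₁, ← hr, ← hc,
      ← Nat.mod_add_div (E (r, c) : ℕ) n₁, hmod, hdiv]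
  have ht : E.symm t = (i, j) := by
    rw [Equiv.symm_apply_eq, Fin.ext_iff, ← Nat.mod_add_div (t : ℕ) n₁, ← hi, ← hj,
      ← Nat.mod_add_div (E (i, j) : ℕ) n₁, hmod, hdiv]
  rw [hinv, submatrix_apply, hk, ht]

theorem freund_alpha_sq_sub_one_ge {lo hi : ℝ} (hlo : 0 < lo) (hlt : lo < hi) (ω : ℝ) :
    4 * (lo * hi + ω ^ 2) / (hi - lo) ^ 2 ≤
      ((√(lo ^ 2 + ω ^ 2) + √(hi ^ 2 + ω ^ 2)) / (hi - lo)) ^ 2 - 1 := by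
  have hd : 0 < hi - lo := by linarith
  have h1 := Real.sq_sqrt (show 0 ≤ lo ^ 2 + ω ^ 2 by positivity)
  have h2 := Real.sq_sqrt (show 0 ≤ hi ^ 2 + ω ^ 2 by positivity)
  have h3 : lo * hi + ω ^ 2 ≤ √(lo ^ 2 + ω ^ 2) * √(hi ^ 2 + ω ^ 2) := by
    rw [← Real.sqrt_mul (by positivity)]
    apply Real.le_sqrt_of_sq_le
    nlinarith [sq_nonneg (ω * (hi - lo))]
  rw [div_pow, div_sub_one (by positivity)]
  gcongr
  nlinarith

theorem one_lt_freund_alpha {lo hi : ℝ} (hlo : 0 < lo) (hlt : lo < hi) (ω : ℝ) :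
    1 < (√(lo ^ 2 + ω ^ 2) + √(hi ^ 2 + ω ^ 2)) / (hi - lo) := by
  have hd : 0 < hi - lo := by linarith
  have h := freund_alpha_sq_sub_one_ge hlo hlt ω
  have : 0 < 4 * (lo * hi + ω ^ 2) / (hi - lo) ^ 2 := by
    have := mul_pos hlo (hlo.trans hlt)
    positivity
  exact (one_lt_sq_iff₀ (by positivity)).1 (by linarith)

theorem sq_div_sq_sub_one_sq_eq {α R : ℝ} (hα : 1 < α) (hR : R = α + √(α ^ 2 - 1)) :
    R ^ 2 / (R ^ 2 - 1) ^ 2 = 1 / (4 * (α ^ 2 - 1)) := by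
  have hpos : 0 < α ^ 2 - 1 := by nlinarith
  have hs := Real.sq_sqrt hpos.le
  have hR0 : 0 < R := by rw [hR]; positivity
  have h : R ^ 2 - 1 = 2 * √(α ^ 2 - 1) * R := by rw [hR]; linear_combination -hs
  rw [h, mul_pow, mul_pow, hs]
  field_simp
  norm_num

theorem integrable_freund_bound {lo₁ hi₁ lo₂ hi₂ : ℝ} (hlo₁ : 0 < lo₁) (hlt₁ : lo₁ < hi₁)
    (hlo₂ : 0 < lo₂) (hlt₂ : lo₂ < hi₂) {α₁ R₁ α₂ R₂ : ℝ → ℝ}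
    (hα₁ : ∀ ω : ℝ, α₁ ω = (√(lo₁ ^ 2 + ω ^ 2) + √(hi₁ ^ 2 + ω ^ 2)) / (hi₁ - lo₁))
    (hR₁ : ∀ ω : ℝ, R₁ ω = α₁ ω + √(α₁ ω ^ 2 - 1))
    (hα₂ : ∀ ω : ℝ, α₂ ω = (√(lo₂ ^ 2 + ω ^ 2) + √(hi₂ ^ 2 + ω ^ 2)) / (hi₂ - lo₂))
    (hR₂ : ∀ ω : ℝ, R₂ ω = α₂ ω + √(α₂ ω ^ 2 - 1)) (a b : ℕ) :
    Integrable fun ω : ℝ => (R₁ ω ^ 2 / (R₁ ω ^ 2 - 1) ^ 2) * (R₂ ω ^ 2 / (R₂ ω ^ 2 - 1) ^ 2) *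
      (1 / R₁ ω) ^ a * (1 / R₂ ω) ^ b := by
  have key : ∀ {lo hi : ℝ}, 0 < lo → lo < hi → ∀ {α R : ℝ → ℝ},
      (∀ ω : ℝ, α ω = (√(lo ^ 2 + ω ^ 2) + √(hi ^ 2 + ω ^ 2)) / (hi - lo)) →
      (∀ ω : ℝ, R ω = α ω + √(α ω ^ 2 - 1)) → Measurable R ∧ ∀ ω, 1 ≤ R ω ∧
        R ω ^ 2 / (R ω ^ 2 - 1) ^ 2 ≤ (hi - lo) ^ 2 / (16 * (lo * hi + ω ^ 2)) := by
    intro lo hi hlo hlt α R hα hR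
    constructor
    · rw [funext hR, funext hα]
      fun_prop
    · intro ω
      have h1 := one_lt_freund_alpha hlo hlt ω
      have h2 := freund_alpha_sq_sub_one_ge hlo hlt ω
      rw [← hα] at h1 h2
      have hd : 0 < hi - lo := by linarith
      have hp := mul_pos hlo (hlo.trans hlt)
      refine ⟨by rw [hR]; linarith [Real.sqrt_nonneg (α ω ^ 2 - 1)], ?_⟩
      rw [sq_div_sq_sub_one_sq_eq h1 (hR ω)]
      calc 1 / (4 * (α ω ^ 2 - 1)) ≤ 1 / (4 * (4 * (lo * hi + ω ^ 2) / (hi - lo) ^ 2)) := by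
            gcongr
        _ = _ := by field_simp; norm_num
  obtain ⟨hm₁, hb₁⟩ := key hlo₁ hlt₁ hα₁ hR₁
  obtain ⟨hm₂, hb₂⟩ := key hlo₂ hlt₂ hα₂ hR₂
  have hp₁ := mul_pos hlo₁ (hlo₁.trans hlt₁)
  have hp₂ := mul_pos hlo₂ (hlo₂.trans hlt₂)
  have hdom := (integrable_div_sq_add_sq (Real.sqrt_pos.2 hp₁)).const_mul
    ((hi₁ - lo₁) ^ 2 / (16 * √(lo₁ * hi₁)) * ((hi₂ - lo₂) ^ 2 / (16 * (lo₂ * hi₂))))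
  refine hdom.mono' (by fun_prop) (Filter.Eventually.of_forall fun ω => ?_)
  have hR₁0 : 0 < R₁ ω := by linarith [(hb₁ ω).1]
  have hR₂0 : 0 < R₂ ω := by linarith [(hb₂ ω).1]
  rw [Real.norm_of_nonneg (by positivity)]
  calc _ ≤ ((hi₁ - lo₁) ^ 2 / (16 * (lo₁ * hi₁ + ω ^ 2))) *
          ((hi₂ - lo₂) ^ 2 / (16 * (lo₂ * hi₂ + ω ^ 2))) * 1 * 1 := by
        refine mul_le_mul (mul_le_mul (mul_le_mul (hb₁ ω).2 (hb₂ ω).2 ?_ ?_) ?_ ?_ ?_) ?_ ?_ ?_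
        · positivity
        · positivity
        · exact pow_le_one₀ (by positivity) ((div_le_one hR₁0).2 (hb₁ ω).1)
        · positivity
        · positivity
        · exact pow_le_one₀ (by positivity) ((div_le_one hR₂0).2 (hb₂ ω).1)
        · positivity
        · positivity
    _ ≤ ((hi₁ - lo₁) ^ 2 / (16 * (lo₁ * hi₁ + ω ^ 2))) *
          ((hi₂ - lo₂) ^ 2 / (16 * (lo₂ * hi₂))) := by
        rw [mul_one, mul_one]
        gcongr
        linarith [sq_nonneg ω]
    _ = _ := by
        rw [Real.sq_sqrt hp₁.le]
        have := Real.sqrt_pos.2 hp₁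
        generalize √(lo₁ * hi₁) = y at this
        field_simp

/-- Proposition 4.3: integral bound for the entries of `S_g⁻¹` where
`S_g = M₁ ⊗ I + I ⊗ M₂` with `M₁, M₂` tridiagonal SPD, when the row grid index
of `k` differs from `i` and the column grid index of `k` differs from `j`. -/
theorem kronSum2_inv_entry_integral_bound
    (n₁ n₂ : ℕ)
    (M₁ : Matrix (Fin n₁) (Fin n₁) ℝ) (M₂ : Matrix (Fin n₂) (Fin n₂) ℝ)
    (hM₁ : M₁.PosDef) (hM₂ : M₂.PosDef)
    (htri₁ : ∀ a c : Fin n₁, 1 < |(a : ℤ) - (c : ℤ)| → M₁ a c = 0)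
    (htri₂ : ∀ a c : Fin n₂, 1 < |(a : ℤ) - (c : ℤ)| → M₂ a c = 0)
    (lammin₁ lammax₁ lammin₂ lammax₂ : ℝ)
    (hmin₁ : IsLeast (Set.range hM₁.1.eigenvalues) lammin₁)
    (hmax₁ : IsGreatest (Set.range hM₁.1.eigenvalues) lammax₁)
    (hmin₂ : IsLeast (Set.range hM₂.1.eigenvalues) lammin₂)
    (hmax₂ : IsGreatest (Set.range hM₂.1.eigenvalues) lammax₂)
    (hlt₁ : lammin₁ < lammax₁) (hlt₂ : lammin₂ < lammax₂)
    (δ : ℝ) (hδ : δ = (lammax₁ - lammin₁) * (lammax₂ - lammin₂))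
    (k t : ℕ) (hk1 : 1 ≤ k) (hk2 : k ≤ n₁ * n₂) (ht1 : 1 ≤ t) (ht2 : t ≤ n₁ * n₂)
    (i j ℓ m : ℕ)
    (hj : j = (t - 1) / n₁ + 1) (hi : i = t - n₁ * ((t - 1) / n₁))
    (hm : m = (k - 1) / n₁ + 1) (hl : ℓ = k - n₁ * ((k - 1) / n₁))
    (hne1 : ℓ ≠ i) (hne2 : m ≠ j)
    (α₁ R₁ α₂ R₂ : ℝ → ℝ)
    (hα₁ : ∀ ω : ℝ, α₁ ω =
      (Real.sqrt (lammin₁ ^ 2 + ω ^ 2) + Real.sqrt (lammax₁ ^ 2 + ω ^ 2)) / (lammax₁ - lammin₁))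
    (hR₁ : ∀ ω : ℝ, R₁ ω = α₁ ω + Real.sqrt (α₁ ω ^ 2 - 1))
    (hα₂ : ∀ ω : ℝ, α₂ ω =
      (Real.sqrt (lammin₂ ^ 2 + ω ^ 2) + Real.sqrt (lammax₂ ^ 2 + ω ^ 2)) / (lammax₂ - lammin₂))
    (hR₂ : ∀ ω : ℝ, R₂ ω = α₂ ω + Real.sqrt (α₂ ω ^ 2 - 1)) :
    |(kronSum2 n₁ n₂ M₁ M₂)⁻¹ ⟨k - 1, by omega⟩ ⟨t - 1, by omega⟩| ≤
      (1 / (2 * Real.pi)) * (64 / δ) *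
        ∫ ω : ℝ, (R₁ ω ^ 2 / (R₁ ω ^ 2 - 1) ^ 2) * (R₂ ω ^ 2 / (R₂ ω ^ 2 - 1) ^ 2) *
          (1 / R₁ ω) ^ (|(i : ℝ) - (ℓ : ℝ)| - 1) *
          (1 / R₂ ω) ^ (|(j : ℝ) - (m : ℝ)| - 1) := by

  have hn₁ : 0 < n₁ := Nat.pos_of_ne_zero fun h => by simp [h] at hk2; omega
  have hpos₁ : 0 < lammin₁ := by
    obtain ⟨e, he⟩ := hmin₁.1
    exact he ▸ hM₁.eigenvalues_pos e
  have hpos₂ : 0 < lammin₂ := by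
    obtain ⟨e, he⟩ := hmin₂.1
    exact he ▸ hM₂.eigenvalues_pos e
  let r : Fin n₁ := ⟨(k - 1) % n₁, Nat.mod_lt _ hn₁⟩
  let i' : Fin n₁ := ⟨(t - 1) % n₁, Nat.mod_lt _ hn₁⟩
  let c : Fin n₂ := ⟨(k - 1) / n₁, Nat.div_lt_of_lt_mul (by omega)⟩
  let j' : Fin n₂ := ⟨(t - 1) / n₁, Nat.div_lt_of_lt_mul (by omega)⟩
  have hℓr : ℓ = r + 1 := by
    have := Nat.mod_add_div (k - 1) n₁
    simp only [r]; omega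
  have hii' : i = i' + 1 := by
    have := Nat.mod_add_div (t - 1) n₁
    simp only [i']; omega
  have hmc : m = c + 1 := hm
  have hjj' : j = j' + 1 := hj
  have hexp : ∀ {x y : ℕ}, x ≠ y → ∃ n : ℕ, |(y : ℝ) - (x : ℝ)| - 1 = n ∧
      (n : ℤ) < |(x : ℤ) - (y : ℤ)| := by
    intro x y hxy
    obtain ⟨n, hn⟩ : ∃ n : ℕ, |(y : ℤ) - (x : ℤ)| - 1 = n := Int.eq_ofNat_of_zero_le (by
      have : 0 < |(y : ℤ) - (x : ℤ)| := abs_pos.2 (by omega)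
      omega)
    refine ⟨n, by exact_mod_cast congrArg (Int.cast : ℤ → ℝ) hn, ?_⟩
    rw [abs_sub_comm]
    omega
  obtain ⟨a, ha, ha'⟩ := hexp hne1
  obtain ⟨b, hb, hb'⟩ := hexp hne2
  have hra : (a : ℤ) < |((r : ℕ) : ℤ) - ((i' : ℕ) : ℤ)| := by
    rw [hℓr, hii'] at ha'
    push_cast at ha'
    rwa [add_sub_add_right_eq_sub] at ha'
  have hcb : (b : ℤ) < |((c : ℕ) : ℤ) - ((j' : ℕ) : ℤ)| := by
    rw [hmc, hjj'] at hb'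
    push_cast at hb'
    rwa [add_sub_add_right_eq_sub] at hb'
  simp only [ha, hb, Real.rpow_natCast]
  rw [kronSum2_inv_apply hM₁ hM₂ _ _ r i' c j' rfl rfl rfl rfl,
    sum_div_add_eq_integral _ _ _ _ hM₁.eigenvalues_pos hM₂.eigenvalues_pos, abs_mul,
    abs_of_pos (show 0 < 1 / (2 * π) by positivity), mul_assoc (1 / (2 * π))]
  refine mul_le_mul_of_nonneg_left ?_ (by positivity)
  rw [← integral_const_mul, ← Real.norm_eq_abs]
  refine norm_integral_le_of_norm_le
    ((integrable_freund_bound hpos₁ hlt₁ hpos₂ hlt₂ hα₁ hR₁ hα₂ hR₂ a b).const_mul _)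
    (Filter.Eventually.of_forall fun ω => ?_)
  rw [Real.norm_eq_abs]
  refine (Complex.abs_re_le_norm _).trans ?_
  rw [norm_mul]
  have hb₁ := hM₁.1.norm_resolvent_entry_le htri₁ (fun e => hmin₁.2 ⟨e, rfl⟩)
    (fun e => hmax₁.2 ⟨e, rfl⟩) hlt₁ (ω * Complex.I) (α := α₁ ω)
    (by rw [hα₁, Complex.norm_add_mul_I, Complex.norm_add_mul_I])
    (by rw [hα₁]; exact one_lt_freund_alpha hpos₁ hlt₁ ω) (hR₁ ω) hra
  have hb₂ := hM₂.1.norm_resolvent_entry_le htri₂ (fun e => hmin₂.2 ⟨e, rfl⟩)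
    (fun e => hmax₂.2 ⟨e, rfl⟩) hlt₂ (((-ω : ℝ) : ℂ) * Complex.I) (α := α₂ ω)
    (by rw [hα₂, Complex.norm_add_mul_I, Complex.norm_add_mul_I, neg_sq])
    (by rw [hα₂]; exact one_lt_freund_alpha hpos₂ hlt₂ ω) (hR₂ ω) hcb
  refine (mul_le_mul hb₁ hb₂ (norm_nonneg _) ((norm_nonneg _).trans hb₁)).trans_eq ?_
  have hd₁ : lammax₁ - lammin₁ ≠ 0 := by linarith
  have hd₂ : lammax₂ - lammin₂ ≠ 0 := by linarith
  rw [hδ, show (64 : ℝ) / ((lammax₁ - lammin₁) * (lammax₂ - lammin₂)) =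
    8 / (lammax₁ - lammin₁) * (8 / (lammax₂ - lammin₂)) by field_simp; norm_num]
  ring
end

section
/- Let M be an n×n real symmetric positive definite b-banded matrix with smallest eigenvalue λ_min and largest eigenvalue λ_max, λ_min < λ_max. For ω ∈ ℝ define α(ω) = (√(λ_min² + ω²) + √(λ_max² + ω²))/(λ_max − λ_min) and R(ω) = α(ω) + √(α(ω)² − 1). Then for all indices ℓ ≠ i in {1, …, n} and all ω ∈ ℝ, |e_ℓᵀ (iωI + M)⁻¹ e_i| ≤ (2R(ω)/(λ_max − λ_min)) · (4R(ω)²/(R(ω)² − 1)²) · (1/R(ω))^{|ℓ−i|/b}. -/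
open MeasureTheory Real Matrix

open Polynomial in
/-- Chebyshev polynomials in the Joukowski variable. -/
theorem Polynomial.Chebyshev.eval_T_add_inv_div_two {z : ℂ} (hz : z ≠ 0) (n : ℤ) :
    (Chebyshev.T ℂ n).eval ((z + z⁻¹) / 2) = (z ^ n + (z ^ n)⁻¹) / 2 := by
  obtain ⟨θ, rfl⟩ : ∃ θ : ℂ, z = Complex.exp (θ * Complex.I) :=
    ⟨-Complex.log z * Complex.I, by
      rw [mul_assoc, Complex.I_mul_I]; simp [Complex.exp_log hz]⟩
  have h := Chebyshev.T_complex_cos θ n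
  rw [Complex.cos, Complex.cos] at h
  rw [← Complex.exp_neg, ← Complex.exp_int_mul, ← Complex.exp_neg]
  convert h using 4 <;> ring_nf

/-- Every complex `a` is the Joukowski image of some `w` outside the open unit disc. -/
theorem exists_one_le_norm_add_inv_div_two_eq (a : ℂ) :
    ∃ w : ℂ, 1 ≤ ‖w‖ ∧ (w + w⁻¹) / 2 = a := by
  obtain ⟨s, hs⟩ := IsAlgClosed.exists_pow_nat_eq (a ^ 2 - 1) (n := 2) (by norm_num)
  have hprod : (a + s) * (a - s) = 1 := by linear_combination -hs
  have hinv : (a + s)⁻¹ = a - s := inv_eq_of_mul_eq_one_right hprod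
  have hinv' : (a - s)⁻¹ = a + s := by rw [← hinv, inv_inv]
  rcases le_total 1 ‖a + s‖ with h | h
  · exact ⟨a + s, h, by rw [hinv]; ring⟩
  · refine ⟨a - s, ?_, by rw [hinv']; ring⟩
    have hn : ‖a + s‖ * ‖a - s‖ = 1 := by rw [← norm_mul, hprod, norm_one]
    nlinarith [norm_nonneg (a - s), norm_nonneg (a + s)]

/-- The Joukowski map sends the circle of radius `‖w‖` to an ellipse with foci `±1`. -/
theorem norm_sub_one_add_norm_add_one {w : ℂ} (hw : w ≠ 0) :
    ‖(w + w⁻¹) / 2 - 1‖ + ‖(w + w⁻¹) / 2 + 1‖ = ‖w‖ + ‖w‖⁻¹ := by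
  have h1 : (w + w⁻¹) / 2 - 1 = (w - 1) ^ 2 / (2 * w) := by field_simp; ring
  have h2 : (w + w⁻¹) / 2 + 1 = (w + 1) ^ 2 / (2 * w) := by field_simp; ring
  have hn : ‖w‖ ≠ 0 := norm_ne_zero_iff.mpr hw
  have hp := parallelogram_law_with_norm ℝ w 1
  rw [norm_one] at hp
  rw [h1, h2]
  simp only [norm_div, norm_pow, norm_mul, Complex.norm_ofNat]
  field_simp
  linarith

theorem eq_add_sqrt_sq_sub_one {r α : ℝ} (hr : 1 ≤ r) (h : r + r⁻¹ = 2 * α) :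
    r = α + √(α ^ 2 - 1) := by
  have hr0 : r ≠ 0 := by positivity
  have hα : α = (r + r⁻¹) / 2 := by linarith
  have hsq : α ^ 2 - 1 = ((r - r⁻¹) / 2) ^ 2 := by rw [hα]; field_simp; ring
  have hinv : r⁻¹ ≤ 1 := inv_le_one_of_one_le₀ hr
  rw [hsq, sqrt_sq (by linarith), hα]
  ring

open Polynomial in
/-- The Chebyshev form of the numerator of the near-best approximation error of a pole: with
`t = (z + z⁻¹) / 2` its value is
`z ^ m * (conj w * z - 1) * (z⁻¹ - w) + z ^ (-m) * (conj w * z⁻¹ - 1) * (z - w)`. -/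
noncomputable def freundNumerator (w : ℂ) (m : ℕ) : ℂ[X] :=
  C (2 * (starRingEnd ℂ w + w)) * Chebyshev.T ℂ m
    - C (2 * (w * starRingEnd ℂ w)) * Chebyshev.T ℂ (m + 1) - C 2 * Chebyshev.T ℂ (m - 1)

open Polynomial in
theorem natDegree_freundNumerator_le (w : ℂ) (m : ℕ) :
    (freundNumerator w m).natDegree ≤ m + 1 := by
  have h (c : ℂ) (k : ℤ) (hk : k.natAbs ≤ m + 1) :
      (C c * Chebyshev.T ℂ k).natDegree ≤ m + 1 :=
    (natDegree_C_mul_le _ _).trans ((Chebyshev.natDegree_T ℂ k).le.trans hk)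
  exact natDegree_sub_le_of_le (natDegree_sub_le_of_le (h _ _ (by omega)) (h _ _ (by omega)))
    (h _ _ (by omega)) |>.trans (by simp)

theorem eval_freundNumerator (w : ℂ) (m : ℕ) {z : ℂ} (hz : z ≠ 0) :
    (freundNumerator w m).eval ((z + z⁻¹) / 2) =
      z ^ m * (starRingEnd ℂ w * z - 1) * (z⁻¹ - w)
        + (z ^ m)⁻¹ * (starRingEnd ℂ w * z⁻¹ - 1) * (z - w) := by
  simp only [freundNumerator, Polynomial.eval_sub, Polynomial.eval_mul, Polynomial.eval_C,
    Polynomial.Chebyshev.eval_T_add_inv_div_two hz, zpow_add₀ hz, zpow_sub₀ hz, zpow_natCast,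
    zpow_one]
  field_simp
  ring

theorem norm_conj_mul_sub_one (w : ℂ) {z : ℂ} (hz : ‖z‖ = 1) :
    ‖starRingEnd ℂ w * z - 1‖ = ‖z - w‖ := by
  have h : starRingEnd ℂ w * z - 1 = starRingEnd ℂ (w - z) * z := by
    have := Complex.conj_mul' z
    rw [hz] at this
    push_cast at this
    rw [map_sub, sub_mul, this, one_pow]
  rw [h, norm_mul, RCLike.norm_conj, hz, mul_one, norm_sub_rev]

theorem norm_eval_freundNumerator_le {w : ℂ} (hw : w ≠ 0) (m : ℕ) {t : ℝ}
    (ht : t ∈ Set.Icc (-1) 1) :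
    ‖(freundNumerator w m).eval (t : ℂ)‖ ≤ 4 * ‖w‖ * ‖(t : ℂ) - (w + w⁻¹) / 2‖ := by
  obtain ⟨z, hz, hzt⟩ : ∃ z : ℂ, ‖z‖ = 1 ∧ (t : ℂ) = (z + z⁻¹) / 2 := by
    refine ⟨Complex.exp (arccos t * Complex.I), Complex.norm_exp_ofReal_mul_I _, ?_⟩
    rw [← Complex.exp_neg, ← neg_mul, ← Complex.cos, ← Complex.ofReal_cos,
      cos_arccos ht.1 ht.2]
  have hz0 : z ≠ 0 := norm_ne_zero_iff.mp (by simp [hz])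
  have hz' : ‖z⁻¹‖ = 1 := by simp [hz]
  have hfac : (z - w) * (z⁻¹ - w) = -2 * w * ((z + z⁻¹) / 2 - (w + w⁻¹) / 2) := by
    field_simp
    ring
  have hn : ‖z - w‖ * ‖z⁻¹ - w‖ = 2 * ‖w‖ * ‖(z + z⁻¹) / 2 - (w + w⁻¹) / 2‖ := by
    rw [← norm_mul, hfac]
    simp
  rw [hzt, eval_freundNumerator w m hz0]
  refine (norm_add_le _ _).trans ?_
  simp only [norm_mul, norm_inv, norm_pow, norm_conj_mul_sub_one w hz, hz]
  rw [norm_conj_mul_sub_one w hz']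
  simp only [one_pow, inv_one, one_mul]
  linarith

theorem le_norm_eval_freundNumerator {w : ℂ} (hw : 1 < ‖w‖) (m : ℕ) :
    ‖w‖ ^ m * (‖w‖ ^ 2 - 1) ^ 2 / ‖w‖ ≤ ‖(freundNumerator w m).eval ((w + w⁻¹) / 2)‖ := by
  have hw0 : w ≠ 0 := norm_pos_iff.mp (by linarith)
  have hval : (freundNumerator w m).eval ((w + w⁻¹) / 2)
      = w ^ m * ((‖w‖ ^ 2 - 1 : ℝ) : ℂ) * ((1 - w ^ 2) / w) := by
    rw [eval_freundNumerator w m hw0, Complex.conj_mul']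
    push_cast
    field_simp
    ring
  have h1 : ‖w‖ ^ 2 - 1 ≤ ‖1 - w ^ 2‖ := by
    have := norm_sub_norm_le (w ^ 2) 1
    rwa [norm_pow, norm_one, norm_sub_rev] at this
  have h2 : 0 < ‖w‖ ^ 2 - 1 := by nlinarith
  rw [hval, norm_mul, norm_mul, norm_div, norm_pow, Complex.norm_real, norm_of_nonneg h2.le,
    mul_div_assoc, mul_assoc, sq (‖w‖ ^ 2 - 1), mul_div_assoc]
  gcongr

open Polynomial in
/-- Freund's estimate: polynomial approximation of a simple pole on `[-1, 1]`. -/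
theorem exists_polynomial_approx_pole {w : ℂ} (hw : 1 < ‖w‖) (m : ℕ) :
    ∃ p : ℂ[X], p.natDegree ≤ m ∧ ∀ t : ℝ, t ∈ Set.Icc (-1) 1 →
      (t : ℂ) ≠ (w + w⁻¹) / 2 →
      ‖((t : ℂ) - (w + w⁻¹) / 2)⁻¹ - p.eval (t : ℂ)‖ ≤
        4 * ‖w‖ ^ 2 / (‖w‖ ^ 2 - 1) ^ 2 * (‖w‖ ^ m)⁻¹ := by
  have hw0 : w ≠ 0 := norm_pos_iff.mp (by linarith)
  have hwpos : 0 < ‖w‖ := by linarith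
  have hgap : 0 < ‖w‖ ^ 2 - 1 := by nlinarith
  have hlow := le_norm_eval_freundNumerator hw m
  set a := (w + w⁻¹) / 2 with ha
  set N := freundNumerator w m with hN
  have hNpos : 0 < ‖N.eval a‖ := lt_of_lt_of_le (by positivity) hlow
  have hNa : N.eval a ≠ 0 := norm_pos_iff.mp hNpos
  refine ⟨C (-(N.eval a)⁻¹) * (N /ₘ (X - C a)), ?_, fun t ht hta => ?_⟩
  · refine (natDegree_C_mul_le _ _).trans ?_
    rw [natDegree_divByMonic _ (monic_X_sub_C _), natDegree_X_sub_C]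
    have := natDegree_freundNumerator_le w m
    rw [← hN] at this
    omega
  have hdiv : N.eval (t : ℂ) = N.eval a + (t - a) * (N /ₘ (X - C a)).eval (t : ℂ) := by
    conv_lhs => rw [← modByMonic_add_div N (X - C a), modByMonic_X_sub_C_eq_C_eval]
    simp
  have hta' : (t : ℂ) - a ≠ 0 := sub_ne_zero.mpr hta
  have herr : ((t : ℂ) - a)⁻¹ - (C (-(N.eval a)⁻¹) * (N /ₘ (X - C a))).eval (t : ℂ)
      = N.eval (t : ℂ) / (N.eval a * (t - a)) := by
    rw [hdiv, eval_mul, eval_C]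
    field_simp
    ring
  have htpos : 0 < ‖(t : ℂ) - a‖ := norm_pos_iff.mpr hta'
  rw [herr, norm_div, norm_mul]
  calc ‖N.eval (t : ℂ)‖ / (‖N.eval a‖ * ‖(t : ℂ) - a‖)
      ≤ 4 * ‖w‖ * ‖(t : ℂ) - a‖ / (‖w‖ ^ m * (‖w‖ ^ 2 - 1) ^ 2 / ‖w‖ * ‖(t : ℂ) - a‖) := by
        gcongr
        exact norm_eval_freundNumerator_le hw0 m ht
    _ = 4 * ‖w‖ ^ 2 / (‖w‖ ^ 2 - 1) ^ 2 * (‖w‖ ^ m)⁻¹ := by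
        field_simp

open Polynomial in
/-- Freund's estimate on an interval `[lo, hi]` with pole at `-I * ω`. -/
theorem exists_polynomial_approx_shifted_inv {lo hi : ℝ} (hlo : 0 < lo) (hlt : lo < hi)
    (ω : ℝ) {α R : ℝ} (hα : α = (√(lo ^ 2 + ω ^ 2) + √(hi ^ 2 + ω ^ 2)) / (hi - lo))
    (hR : R = α + √(α ^ 2 - 1)) :
    1 < R ∧ ∀ m : ℕ, ∃ p : ℂ[X], p.natDegree ≤ m ∧ ∀ x ∈ Set.Icc lo hi,
      ‖(Complex.I * ω + (x : ℂ))⁻¹ - p.eval (x : ℂ)‖ ≤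
        2 / (hi - lo) * (4 * R ^ 2 / (R ^ 2 - 1) ^ 2 * (R ^ m)⁻¹) := by
  have hΔ : 0 < hi - lo := sub_pos.mpr hlt
  have hΔc : (hi : ℂ) - lo ≠ 0 := by exact_mod_cast hΔ.ne'
  obtain ⟨w, hw1, hwa⟩ := exists_one_le_norm_add_inv_div_two_eq
    (-(2 * (Complex.I * ω) + hi + lo) / (hi - lo))
  have hw0 : w ≠ 0 := norm_pos_iff.mp (by linarith)
  have hnorm (x : ℝ) : ‖Complex.I * ω + (x : ℂ)‖ = √(x ^ 2 + ω ^ 2) := by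
    rw [add_comm, mul_comm, Complex.norm_add_mul_I]
  have hsum := norm_sub_one_add_norm_add_one hw0
  have h1 : ‖(w + w⁻¹) / 2 - 1‖ = 2 * √(hi ^ 2 + ω ^ 2) / (hi - lo) := by
    have : (w + w⁻¹) / 2 - 1 = -2 * (Complex.I * ω + (hi : ℂ)) / ((hi - lo : ℝ) : ℂ) := by
      rw [hwa]
      push_cast
      field_simp
      ring
    rw [this, norm_div, norm_mul, hnorm, Complex.norm_real, norm_of_nonneg hΔ.le]
    simp
  have h2 : ‖(w + w⁻¹) / 2 + 1‖ = 2 * √(lo ^ 2 + ω ^ 2) / (hi - lo) := by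
    have : (w + w⁻¹) / 2 + 1 = -2 * (Complex.I * ω + (lo : ℂ)) / ((hi - lo : ℝ) : ℂ) := by
      rw [hwa]
      push_cast
      field_simp
      ring
    rw [this, norm_div, norm_mul, hnorm, Complex.norm_real, norm_of_nonneg hΔ.le]
    simp
  have hwα : ‖w‖ + ‖w‖⁻¹ = 2 * α := by
    rw [← hsum, h1, h2, hα]
    ring
  have hwR : ‖w‖ = R := by rw [hR]; exact eq_add_sqrt_sq_sub_one hw1 hwα
  have hα1 : 1 < α := by
    rw [hα, lt_div_iff₀ hΔ]
    have e1 : lo ≤ √(lo ^ 2 + ω ^ 2) := le_sqrt_of_sq_le (by nlinarith)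
    have e2 : hi ≤ √(hi ^ 2 + ω ^ 2) := le_sqrt_of_sq_le (by nlinarith)
    linarith
  have hR1 : 1 < R := by
    have := sqrt_nonneg (α ^ 2 - 1)
    linarith
  refine ⟨hR1, fun m => ?_⟩
  obtain ⟨q, hqdeg, hq⟩ := exists_polynomial_approx_pole (w := w) (by rwa [hwR]) m
  rw [hwR] at hq
  refine ⟨C (2 / ((hi : ℂ) - lo)) *
    q.comp (C (2 / ((hi : ℂ) - lo)) * X - C (((hi : ℂ) + lo) / (hi - lo))), ?_, fun x hx => ?_⟩
  · refine (natDegree_C_mul_le _ _).trans (natDegree_comp_le.trans ?_)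
    have : (C (2 / ((hi : ℂ) - lo)) * X - C (((hi : ℂ) + lo) / (hi - lo))).natDegree ≤ 1 := by
      compute_degree
    nlinarith
  set t : ℝ := (2 * x - (hi + lo)) / (hi - lo) with ht
  have htmem : t ∈ Set.Icc (-1 : ℝ) 1 := by
    constructor
    · rw [ht, le_div_iff₀ hΔ]; linarith [hx.1]
    · rw [ht, div_le_iff₀ hΔ]; linarith [hx.2]
  have hx0 : Complex.I * ω + (x : ℂ) ≠ 0 := by
    intro h
    have := congrArg Complex.re h
    simp at this
    linarith [hx.1]
  have hdiff : (t : ℂ) - (w + w⁻¹) / 2 = 2 / (hi - lo) * (Complex.I * ω + (x : ℂ)) := by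
    rw [hwa, ht]
    push_cast
    field_simp
    ring
  have hne : (t : ℂ) ≠ (w + w⁻¹) / 2 := by
    rw [← sub_ne_zero, hdiff]
    exact mul_ne_zero (div_ne_zero two_ne_zero hΔc) hx0
  have hqt := hq t htmem hne
  have hcomp : (2 / ((hi : ℂ) - lo)) * x - ((hi : ℂ) + lo) / (hi - lo) = (t : ℂ) := by
    rw [ht]
    push_cast
    field_simp
  have herr : (Complex.I * ω + (x : ℂ))⁻¹ - (C (2 / ((hi : ℂ) - lo)) *
      q.comp (C (2 / ((hi : ℂ) - lo)) * X - C (((hi : ℂ) + lo) / (hi - lo)))).eval (x : ℂ)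
      = ((2 / (hi - lo) : ℝ) : ℂ) * (((t : ℂ) - (w + w⁻¹) / 2)⁻¹ - q.eval (t : ℂ)) := by
    rw [hdiff]
    simp only [eval_mul, eval_C, eval_comp, eval_sub, eval_X, hcomp]
    push_cast
    field_simp
  rw [herr, norm_mul, Complex.norm_real, norm_of_nonneg (by positivity)]
  gcongr

theorem Matrix.pow_apply_eq_zero_of_banded {n b : ℕ} {S : Type*} [Semiring S]
    {A : Matrix (Fin n) (Fin n) S}
    (hband : ∀ a c : Fin n, (b : ℤ) < |(a : ℤ) - (c : ℤ)| → A a c = 0) (k : ℕ) :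
    ∀ a c : Fin n, (k * b : ℤ) < |(a : ℤ) - (c : ℤ)| → (A ^ k) a c = 0 := by
  induction k with
  | zero =>
    intro a c h
    rw [pow_zero, one_apply_ne]
    rintro rfl
    simp at h
  | succ k ih =>
    intro a c h
    rw [pow_succ, mul_apply]
    refine Finset.sum_eq_zero fun j _ => ?_
    by_cases hj : (k * b : ℤ) < |(a : ℤ) - (j : ℤ)|
    · rw [ih a j hj, zero_mul]
    · rw [hband j c, mul_zero]
      have := abs_sub_le (a : ℤ) (j : ℤ) (c : ℤ)
      push_cast at h
      linarith

open Polynomial in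
theorem Matrix.aeval_apply_eq_zero_of_banded {n b m : ℕ} {S : Type*} [CommSemiring S]
    {A : Matrix (Fin n) (Fin n) S}
    (hband : ∀ a c : Fin n, (b : ℤ) < |(a : ℤ) - (c : ℤ)| → A a c = 0) {p : S[X]}
    (hp : p.natDegree ≤ m) {a c : Fin n} (hac : (m * b : ℤ) < |(a : ℤ) - (c : ℤ)|) :
    (aeval A p) a c = 0 := by
  rw [aeval_eq_sum_range, sum_apply]
  refine Finset.sum_eq_zero fun k hk => ?_
  have hkm : k ≤ m := by
    rw [Finset.mem_range] at hk
    omega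
  rw [smul_apply, pow_apply_eq_zero_of_banded hband, smul_zero]
  refine lt_of_le_of_lt ?_ hac
  gcongr

theorem Matrix.conj_diagonal_mul_conj_diagonal {ι S : Type*} [Fintype ι] [DecidableEq ι]
    [CommRing S] {V W : Matrix ι ι S} (hVW : V * W = 1) (d e : ι → S) :
    V * diagonal d * W * (V * diagonal e * W) = V * diagonal (fun k => d k * e k) * W := by
  have hWV : W * V = 1 := mul_eq_one_comm.mp hVW
  calc V * diagonal d * W * (V * diagonal e * W)
      = V * diagonal d * (W * V) * diagonal e * W := by simp only [mul_assoc]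
    _ = _ := by rw [hWV, mul_one, mul_assoc V, diagonal_mul_diagonal]

open Polynomial in
theorem Matrix.aeval_conj_diagonal {ι S : Type*} [Fintype ι] [DecidableEq ι] [CommRing S]
    {V W : Matrix ι ι S} (hVW : V * W = 1) (d : ι → S) (p : S[X]) :
    aeval (V * diagonal d * W) p = V * diagonal (fun k => p.eval (d k)) * W := by
  induction p using Polynomial.induction_on with
  | C a =>
    simp only [aeval_C, eval_C]
    rw [← smul_one_eq_diagonal, Matrix.mul_smul, Matrix.smul_mul, mul_one, hVW,
      Algebra.algebraMap_eq_smul_one]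
  | add p q hp hq =>
    simp only [map_add, hp, hq, eval_add]
    rw [← diagonal_add, mul_add, add_mul]
  | monomial k a h =>
    rw [pow_succ, ← mul_assoc, map_mul, h, aeval_X, conj_diagonal_mul_conj_diagonal hVW]
    simp

theorem Matrix.norm_conj_diagonal_apply_le {ι : Type*} [Fintype ι] [DecidableEq ι]
    {U : Matrix ι ι ℝ} (hU : U * Uᵀ = 1) {g : ι → ℂ} {ε : ℝ} (hg : ∀ k, ‖g k‖ ≤ ε) (i j : ι) :
    ‖(U.map Complex.ofReal * diagonal g * (U.map Complex.ofReal)ᵀ) i j‖ ≤ ε := by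
  have hrow (r : ι) : ∑ k, U r k ^ 2 = 1 := by
    have := congrFun (congrFun hU r) r
    simpa [mul_apply, sq] using this
  have hε : 0 ≤ ε := (norm_nonneg _).trans (hg i)
  rw [mul_apply]
  calc ‖∑ k, (U.map Complex.ofReal * diagonal g) i k * (U.map Complex.ofReal)ᵀ k j‖
      ≤ ∑ k, ε * ((U i k ^ 2 + U j k ^ 2) / 2) := by
        refine norm_sum_le_of_le _ fun k _ => ?_
        rw [mul_diagonal, transpose_apply, map_apply, map_apply, norm_mul, norm_mul,
          Complex.norm_real, Complex.norm_real, norm_eq_abs, norm_eq_abs, mul_right_comm,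
          mul_comm]
        gcongr
        · exact hg k
        · nlinarith [sq_nonneg (|U i k| - |U j k|), sq_abs (U i k), sq_abs (U j k)]
    _ = ε := by
        rw [← Finset.mul_sum, ← Finset.sum_div, Finset.sum_add_distrib, hrow, hrow]
        ring

/-- Freund-type resolvent decay estimate for a `b`-banded symmetric positive
definite matrix `M`, combined with the simplification `B(a) ≤ 1/β_R²`:
`|e_ℓᵀ (iωI+M)⁻¹ e_i| ≤ (2R/(λ_max-λ_min)) (4R²/(R²-1)²) (1/R)^{|ℓ-i|/b}`. -/
theorem shifted_resolvent_entry_freund_bound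
    (n b : ℕ) (hb : 0 < b)
    (M : Matrix (Fin n) (Fin n) ℝ) (hM : M.PosDef)
    (hband : ∀ a c : Fin n, (b : ℤ) < |(a : ℤ) - (c : ℤ)| → M a c = 0)
    (lammin lammax : ℝ)
    (hmin : IsLeast (Set.range hM.1.eigenvalues) lammin)
    (hmax : IsGreatest (Set.range hM.1.eigenvalues) lammax)
    (hlt : lammin < lammax)
    (α R : ℝ → ℝ)
    (hα : ∀ ω : ℝ, α ω =
      (Real.sqrt (lammin ^ 2 + ω ^ 2) + Real.sqrt (lammax ^ 2 + ω ^ 2)) / (lammax - lammin))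
    (hR : ∀ ω : ℝ, R ω = α ω + Real.sqrt (α ω ^ 2 - 1))
    (ℓ i : Fin n) (hne : ℓ ≠ i) (ω : ℝ) :
    ‖((Complex.I * (ω : ℂ)) • (1 : Matrix (Fin n) (Fin n) ℂ) +
        M.map Complex.ofReal)⁻¹ ℓ i‖ ≤
      (2 * R ω / (lammax - lammin)) * (4 * R ω ^ 2 / (R ω ^ 2 - 1) ^ 2) *
        (1 / R ω) ^ (|((ℓ : ℕ) : ℝ) - ((i : ℕ) : ℝ)| / b) := by
  have hlo : 0 < lammin := by
    obtain ⟨k, hk⟩ := hmin.1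
    exact hk ▸ hM.eigenvalues_pos k
  obtain ⟨hR1, happrox⟩ :=
    exists_polynomial_approx_shifted_inv hlo hlt ω (hα ω) (hR ω)
  have hΔ : 0 < lammax - lammin := sub_pos.mpr hlt
  have hbpos : (0 : ℝ) < b := by exact_mod_cast hb
  set d : ℝ := |((ℓ : ℕ) : ℝ) - ((i : ℕ) : ℝ)| / b with hd
  have hdpos : 0 < d := by
    refine div_pos (abs_pos.mpr (sub_ne_zero.mpr ?_)) hbpos
    exact_mod_cast fun h => hne (Fin.ext h)
  obtain ⟨m, hm⟩ : ∃ m, ⌈d⌉₊ = m + 1 :=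
    Nat.exists_eq_add_one.mpr (Nat.ceil_pos.mpr hdpos)
  have hmd : (m : ℝ) < d := Nat.lt_ceil.mp (by omega)
  have hdm : d ≤ m + 1 := by
    have := Nat.le_ceil d
    rw [hm] at this
    exact_mod_cast this
  obtain ⟨p, hpdeg, hp⟩ := happrox m
  set U : Matrix (Fin n) (Fin n) ℝ := ↑(hM.1.eigenvectorUnitary)
  have hU : U * Uᵀ = 1 := Unitary.coe_mul_star_self hM.1.eigenvectorUnitary
  set V := U.map Complex.ofReal with hV
  have hVV : V * Vᵀ = 1 := by
    have := congrArg (fun A : Matrix (Fin n) (Fin n) ℝ => A.map Complex.ofRealHom) hU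
    rw [Matrix.map_mul, Matrix.map_one _ (map_zero _) (map_one _)] at this
    exact this
  have hspec : M.map Complex.ofReal =
      V * diagonal (fun k => (hM.1.eigenvalues k : ℂ)) * Vᵀ := by
    have h : M = U * diagonal hM.1.eigenvalues * Uᵀ := hM.1.spectral_theorem
    have := congrArg (fun A : Matrix (Fin n) (Fin n) ℝ => A.map Complex.ofRealHom) h
    rw [Matrix.map_mul, Matrix.map_mul, diagonal_map (map_zero _)] at this
    exact this
  have hmem (k : Fin n) : hM.1.eigenvalues k ∈ Set.Icc lammin lammax :=
    ⟨hmin.2 ⟨k, rfl⟩, hmax.2 ⟨k, rfl⟩⟩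
  have hne0 (k : Fin n) : Complex.I * ω + (hM.1.eigenvalues k : ℂ) ≠ 0 := by
    intro h
    have := congrArg Complex.re h
    simp at this
    linarith [(hmem k).1]
  have hshift : (Complex.I * (ω : ℂ)) • (1 : Matrix (Fin n) (Fin n) ℂ) + M.map Complex.ofReal =
      V * diagonal (fun k => Complex.I * ω + (hM.1.eigenvalues k : ℂ)) * Vᵀ := by
    rw [hspec, ← diagonal_add, mul_add, add_mul, ← smul_one_eq_diagonal, Matrix.mul_smul,
      Matrix.smul_mul, mul_one, hVV]
  have hinv : ((Complex.I * (ω : ℂ)) • (1 : Matrix (Fin n) (Fin n) ℂ) +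
      M.map Complex.ofReal)⁻¹ =
      V * diagonal (fun k => (Complex.I * ω + (hM.1.eigenvalues k : ℂ))⁻¹) * Vᵀ := by
    refine inv_eq_right_inv ?_
    rw [hshift, Matrix.conj_diagonal_mul_conj_diagonal hVV]
    simp only [mul_inv_cancel₀ (hne0 _), diagonal_one, mul_one, hVV]
  have hzero : (Polynomial.aeval (M.map Complex.ofReal) p) ℓ i = 0 := by
    refine Matrix.aeval_apply_eq_zero_of_banded (b := b) (fun a c h => ?_) hpdeg ?_
    · rw [map_apply, hband a c h, Complex.ofReal_zero]
    · rw [hd, lt_div_iff₀ hbpos] at hmd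
      exact_mod_cast hmd
  rw [hspec, Matrix.aeval_conj_diagonal hVV] at hzero
  have hbound := Matrix.norm_conj_diagonal_apply_le hU (fun k => hp _ (hmem k)) ℓ i
  rw [← diagonal_sub, mul_sub, sub_mul, Matrix.sub_apply, ← hV, hzero, sub_zero,
    ← hinv] at hbound
  refine hbound.trans ?_
  have hR0 : 0 < R ω := by linarith
  have hpow : (R ω ^ m)⁻¹ ≤ R ω * (1 / R ω) ^ d := by
    rw [one_div, inv_rpow hR0.le, ← rpow_neg hR0.le, ← rpow_natCast, ← rpow_neg hR0.le]
    nth_rewrite 2 [← rpow_one (R ω)]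
    rw [← rpow_add hR0]
    exact rpow_le_rpow_of_exponent_le hR1.le (by linarith)
  calc 2 / (lammax - lammin) * (4 * R ω ^ 2 / (R ω ^ 2 - 1) ^ 2 * (R ω ^ m)⁻¹)
      ≤ 2 / (lammax - lammin) *
          (4 * R ω ^ 2 / (R ω ^ 2 - 1) ^ 2 * (R ω * (1 / R ω) ^ d)) := by gcongr
    _ = _ := by ring
end
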